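/- Let H be a finite 2-group such that every subgroup of H of order 8 is either cyclic or dihedral. Then H itself is either cyclic or dihedral. -/

import Mathlib

theorem Subgroup.exists_card_eq_two_mul {G : Type*} [Group G] [Finite G] (A : Subgroup G) {b : G}
    (hA : ∀ a ∈ A, b * a * b⁻¹ ∈ A) (hb2 : b * b ∈ A) (hb : b ∉ A) :
    ∃ K : Subgroup G, (∀ x, x ∈ K ↔ x ∈ A ∨ x * b⁻¹ ∈ A) ∧ Nat.card K = 2 * Nat.card A := by
  have hA' : ∀ a ∈ A, b⁻¹ * a * b ∈ A := fun a ha => by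
    have := A.mul_mem (A.mul_mem (A.inv_mem hb2) (hA a ha)) hb2
    convert this using 1
    group
  let K : Subgroup G :=
    { carrier := {x | x ∈ A ∨ x * b⁻¹ ∈ A}
      one_mem' := Or.inl A.one_mem
      mul_mem' := by
        rintro x y (hx | hx) (hy | hy)
        · exact Or.inl (A.mul_mem hx hy)
        · exact Or.inr (by simpa [mul_assoc] using A.mul_mem hx hy)
        · refine Or.inr ?_
          have := A.mul_mem hx (hA y hy)
          convert this using 1
          group
        · refine Or.inl ?_
          have := A.mul_mem (A.mul_mem hx (hA _ hy)) hb2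
          convert this using 1
          group
      inv_mem' := by
        rintro x (hx | hx)
        · exact Or.inl (A.inv_mem hx)
        · refine Or.inr ?_
          have := A.mul_mem (hA' _ (A.inv_mem hx)) (A.inv_mem hb2)
          convert this using 1
          group }
  refine ⟨K, fun x => Iff.rfl, ?_⟩
  have hK : (K : Set G) = (A : Set G) ∪ (fun x => x * b) '' (A : Set G) := by
    ext x
    simp only [Set.mem_union, Set.mem_image, SetLike.mem_coe]
    refine or_congr Iff.rfl ⟨fun h => ⟨_, h, by simp⟩, ?_⟩
    rintro ⟨y, hy, rfl⟩
    simpa using hy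
  have hdisj : Disjoint (A : Set G) ((fun x => x * b) '' (A : Set G)) := by
    rw [Set.disjoint_left]
    rintro _ hx ⟨y, hy, rfl⟩
    exact hb ((A.mul_mem_cancel_left hy).1 hx)
  change Nat.card (K : Set G) = 2 * Nat.card (A : Set G)
  rw [Nat.card_coe_set_eq, Nat.card_coe_set_eq, hK, Set.ncard_union_eq hdisj,
    Set.ncard_image_of_injective _ (mul_left_injective b), two_mul]

theorem IsPGroup.exists_orderOf_pow_eq_four {G : Type*} [Group G] (hG : IsPGroup 2 G) {g : G}
    (hg : g ^ 2 ≠ 1) : ∃ k : ℕ, orderOf (g ^ k) = 4 := by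
  obtain ⟨k, hk⟩ := IsPGroup.iff_orderOf.1 hG g
  have h2 : 2 ≤ k := by
    by_contra! h
    exact hg (orderOf_dvd_iff_pow_eq_one.1 (hk ▸ pow_dvd_pow 2 (by omega : k ≤ 1)))
  obtain ⟨j, rfl⟩ := Nat.exists_eq_add_of_le h2
  refine ⟨2 ^ j, ?_⟩
  rw [orderOf_pow' _ (by positivity), hk, pow_add,
    Nat.gcd_eq_right (Dvd.intro_left _ rfl), Nat.mul_div_cancel _ (by positivity)]
  norm_num

section OrderFour

variable {G : Type*} [Group G] {u : G}

theorem pow_four_of_orderOf (hu : orderOf u = 4) : u ^ 4 = 1 :=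
  hu ▸ pow_orderOf_eq_one u

theorem sq_ne_one_of_orderOf (hu : orderOf u = 4) : u ^ 2 ≠ 1 := fun h => by
  have := orderOf_dvd_of_pow_eq_one h
  rw [hu] at this
  omega

theorem inv_ne_self_of_orderOf (hu : orderOf u = 4) : u⁻¹ ≠ u := fun h =>
  sq_ne_one_of_orderOf hu (by rw [sq]; nth_rw 1 [← h]; simp)

theorem eq_or_eq_inv_of_orderOf (hu : orderOf u = 4)
    (h : ∀ y, Commute y u → y ^ 2 = 1 → y = 1 ∨ y = u ^ 2) {v : G} (hv : orderOf v = 4)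
    (hvu : Commute v u) : v = u ∨ v = u⁻¹ := by
  have hv2 : v ^ 2 = u ^ 2 :=
    (h _ (hvu.pow_left 2) (by rw [← pow_mul]; exact pow_four_of_orderOf hv)).resolve_left
      (sq_ne_one_of_orderOf hv)
  rcases h (v * u) (hvu.mul_left (Commute.refl u))
    (by rw [hvu.mul_pow, hv2, ← pow_add]; exact pow_four_of_orderOf hu) with h1 | h1
  · exact Or.inr (eq_inv_of_mul_eq_one_left h1)
  · rw [sq] at h1
    exact Or.inl (mul_right_cancel h1)

theorem mem_zpowers_iff_of_orderOf (hu : orderOf u = 4) {v : G} :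
    v ∈ Subgroup.zpowers u ↔ v = 1 ∨ v = u ∨ v = u ^ 2 ∨ v = u⁻¹ := by
  refine ⟨fun hv => ?_, ?_⟩
  · have hfin : IsOfFinOrder u := orderOf_pos_iff.1 (by omega)
    obtain ⟨i, rfl⟩ := hfin.mem_powers_iff_mem_zpowers.2 hv
    have h3 : u ^ 3 = u⁻¹ :=
      eq_inv_of_mul_eq_one_left (by rw [← pow_succ]; exact pow_four_of_orderOf hu)
    have hi : i % 4 < 4 := Nat.mod_lt _ (by norm_num)
    simp only [← pow_mod_orderOf u i, hu]
    interval_cases i % 4 <;> simp [h3]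
  · rintro (rfl | rfl | rfl | rfl)
    · exact Subgroup.one_mem _
    · exact Subgroup.mem_zpowers _
    · exact Subgroup.pow_mem _ (Subgroup.mem_zpowers _) 2
    · exact Subgroup.inv_mem _ (Subgroup.mem_zpowers _)

theorem eq_or_eq_inv_of_mem_zpowers (hu : orderOf u = 4) {v : G} (hv : v ∈ Subgroup.zpowers u)
    (hv4 : orderOf v = 4) : v = u ∨ v = u⁻¹ := by
  rcases (mem_zpowers_iff_of_orderOf hu).1 hv with rfl | h | rfl | h
  · simp at hv4
  · exact Or.inl h
  · refine absurd ?_ (sq_ne_one_of_orderOf hv4)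
    rw [← pow_mul]
    exact pow_four_of_orderOf hu
  · exact Or.inr h

theorem eq_one_or_eq_sq_of_mem_zpowers (hu : orderOf u = 4) {v : G}
    (hv : v ∈ Subgroup.zpowers u) (hv2 : v ^ 2 = 1) : v = 1 ∨ v = u ^ 2 := by
  rcases (mem_zpowers_iff_of_orderOf hu).1 hv with h | rfl | h | rfl
  · exact Or.inl h
  · exact absurd hv2 (sq_ne_one_of_orderOf hu)
  · exact Or.inr h
  · exact absurd (by simpa using hv2) (sq_ne_one_of_orderOf hu)

theorem mem_normalizer_zpowers_iff_of_orderOf (hu : orderOf u = 4) {g : G} :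
    g ∈ Subgroup.normalizer (Subgroup.zpowers u : Set G) ↔
      g * u * g⁻¹ = u ∨ g * u * g⁻¹ = u⁻¹ := by
  have hmap : (Subgroup.zpowers u).map (MulAut.conj g).toMonoidHom =
      Subgroup.zpowers (g * u * g⁻¹) := by
    rw [MonoidHom.map_zpowers]
    simp
  refine ⟨fun h => eq_or_eq_inv_of_mem_zpowers hu
    ((Subgroup.mem_normalizer_iff.1 h u).1 (Subgroup.mem_zpowers u)) ?_, fun h => ?_⟩
  · exact (MulEquiv.orderOf_eq (MulAut.conj g) u).trans hu
  · refine Subgroup.mem_normalizer_iff_map_conj_eq.2 (hmap.trans ?_)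
    rcases h with h | h <;> rw [h]
    exact Subgroup.zpowers_inv

end OrderFour

/-- Let `M` be a cyclic subgroup of index two in a 2-group `C`, such that each `x : C` inverts at
most the elements `1` and `u` of `M`. If `C` is not cyclic, there is an involution outside `M`. -/
theorem exists_sq_eq_one_of_not_isCyclic {C : Type*} [Group C] [Finite C] {n : ℕ}
    (hc : Nat.card C = 2 ^ (n + 1)) (M : Subgroup C) [IsCyclic M] (hM : Nat.card M = 2 ^ n)
    {u : C} (hinv : ∀ m ∈ M, ∀ x : C, x⁻¹ * m * x * m = 1 → m = 1 ∨ m = u) (hC : ¬ IsCyclic C) :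
    ∃ y ∉ M, y ^ 2 = 1 := by
  have hidx : M.index = 2 := by
    have := M.card_mul_index
    rw [hc, hM, pow_succ] at this
    exact Nat.eq_of_mul_eq_mul_left (by positivity) this
  have hn : M.Normal := Subgroup.normal_of_index_eq_two hidx
  have : ∃ x, x ∉ M := by
    by_contra! h
    rw [(Subgroup.eq_top_iff' M).2 h] at hidx
    simp at hidx
  obtain ⟨x, hx⟩ := this
  have hx2 : x ^ 2 ∈ M := Subgroup.sq_mem_of_index_two hidx x
  obtain ⟨⟨a, ha⟩, hgen⟩ := IsCyclic.exists_zpow_surjective (G := M)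
  obtain ⟨j, hj⟩ := hgen ⟨x ^ 2, hx2⟩
  replace hj : a ^ j = x ^ 2 := congrArg Subtype.val hj
  rcases Int.even_or_odd' j with ⟨t, rfl | rfl⟩
  · let φ : M →* M :=
      { toFun := fun m => ⟨x⁻¹ * m * x * m,
          M.mul_mem (by simpa using hn.conj_mem m m.2 x⁻¹) m.2⟩
        map_one' := by simp
        map_mul' := fun m m' => by
          have hcomm (p q : M) : (p : C) * q = q * p :=
            congrArg Subtype.val (IsCyclic.isMulCommutative.is_comm.comm p q)
          ext
          have h1 := hcomm ⟨x⁻¹ * m' * x, by simpa using hn.conj_mem m' m'.2 x⁻¹⟩ m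
          simp only [Subgroup.coe_mul] at h1 ⊢
          calc x⁻¹ * (m * m') * x * (m * m')
              = x⁻¹ * m * x * (x⁻¹ * m' * x * m) * m' := by group
            _ = x⁻¹ * m * x * (m * (x⁻¹ * m' * x)) * m' := by rw [h1]
            _ = x⁻¹ * m * x * m * (x⁻¹ * m' * x * m') := by group }
    have hker : Nat.card φ.ker ≤ 2 := by
      have hsub : (fun m : M => (m : C)) '' (φ.ker : Set M) ⊆ {1, u} := by
        rintro _ ⟨m, hm, rfl⟩
        exact hinv m m.2 x (congrArg Subtype.val (MonoidHom.mem_ker.1 hm))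
      have := Set.ncard_le_ncard hsub
      rw [Set.ncard_image_of_injective _ Subtype.val_injective] at this
      exact this.trans ((Set.ncard_insert_le _ _).trans (by simp))
    have hrange : φ.range.index = Nat.card φ.ker := by
      have h1 := φ.range.card_mul_index
      rw [← φ.ker.index_mul_card, Subgroup.index_ker] at h1
      exact Nat.eq_of_mul_eq_mul_left Nat.card_pos h1
    have hsq : (⟨a, ha⟩ ^ (-t) : M) ^ 2 ∈ φ.range := by
      have hpos : 0 < Nat.card φ.ker := Nat.card_pos
      have : φ.range.index = 1 ∨ φ.range.index = 2 := by omega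
      rcases this with h | h
      · rw [Subgroup.index_eq_one.1 h]
        trivial
      · exact Subgroup.sq_mem_of_index_two h _
    obtain ⟨m, hm⟩ := hsq
    replace hm : x⁻¹ * m * x * m = (a ^ (-t)) ^ 2 := congrArg Subtype.val hm
    refine ⟨x * m, fun h => hx ((M.mul_mem_cancel_right m.2).1 h), ?_⟩
    calc (x * m) ^ 2 = x ^ 2 * (x⁻¹ * m * x * m) := by rw [sq, sq]; group
      _ = 1 := by
        rw [hm, ← hj, ← zpow_natCast, ← zpow_mul, ← zpow_add]
        simp [mul_comm]
  · exfalso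
    obtain ⟨p, q, hpq⟩ : IsCoprime (2 * t + 1) ((2 : ℤ) ^ n) :=
      IsCoprime.pow_right ⟨1, -t, by ring⟩
    have ha1 : a ^ ((2 : ℤ) ^ n) = 1 := by
      have : (⟨a, ha⟩ : M) ^ Nat.card M = 1 := pow_card_eq_one'
      rw [hM] at this
      have h1 : a ^ 2 ^ n = 1 := congrArg Subtype.val this
      exact_mod_cast h1
    have hax : a ∈ Subgroup.zpowers x := by
      have : a = (a ^ (2 * t + 1)) ^ p := by
        conv_lhs => rw [← zpow_one a, ← hpq, zpow_add, mul_comm p, mul_comm q, zpow_mul, zpow_mul,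
          ha1, one_zpow, mul_one]
      rw [this, hj]
      exact Subgroup.zpow_mem _ (Subgroup.pow_mem _ (Subgroup.mem_zpowers x) 2) p
    have hMx : M ≤ Subgroup.zpowers x := fun m hm => by
      obtain ⟨i, hi⟩ := hgen ⟨m, hm⟩
      rw [← show a ^ i = m from congrArg Subtype.val hi]
      exact Subgroup.zpow_mem _ hax i
    refine hC ⟨x, fun y => ?_⟩
    by_cases hy : y ∈ M
    · exact hMx hy
    · exact (Subgroup.mul_mem_cancel_right _ (Subgroup.mem_zpowers x)).1
        (hMx ((Subgroup.mul_mem_iff_of_index_two hidx).2 (iff_of_false hy hx)))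

theorem isCyclic_of_orderOf_eq_four {C : Type*} [Group C] [Finite C] {n : ℕ}
    (hc : Nat.card C = 2 ^ n) {u : C} (hu : orderOf u = 4) (hcen : ∀ x, Commute x u)
    (h : ∀ y : C, y ^ 2 = 1 → y = 1 ∨ y = u ^ 2) : IsCyclic C := by
  induction n generalizing C with
  | zero =>
    have := hu ▸ hc ▸ orderOf_dvd_natCard u
    omega
  | succ n ih =>
    by_cases hn : n < 2
    · interval_cases n
      · have := hu ▸ hc ▸ orderOf_dvd_natCard u
        omega
      · exact isCyclic_of_orderOf_eq_card u (by rw [hu, hc]; norm_num)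
    obtain ⟨M, hM, huM⟩ := Sylow.exists_subgroup_card_pow_prime_le 2 (n := 2) (m := n)
      (hc ▸ pow_dvd_pow 2 n.le_succ) (Subgroup.zpowers u)
      (by rw [Nat.card_zpowers, hu]; norm_num) (by omega)
    have huM' : u ∈ M := huM (Subgroup.mem_zpowers u)
    have hMc : IsCyclic M := ih hM (u := ⟨u, huM'⟩) (by rwa [Subgroup.orderOf_mk])
      (fun x => Subtype.ext (hcen x)) (fun y hy =>
        (h y (congrArg Subtype.val hy)).imp (fun h => Subtype.ext h) fun h => Subtype.ext h)
    have hinv : ∀ m ∈ M, ∀ x : C, x⁻¹ * m * x * m = 1 → m = 1 ∨ m = u ^ 2 := by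
      intro m _ x hx
      apply h
      by_contra hm
      obtain ⟨k, hk⟩ := (IsPGroup.of_card hc).exists_orderOf_pow_eq_four hm
      have hmx : x⁻¹ * m ^ k * x = (m ^ k)⁻¹ := by
        rw [← inv_pow, ← eq_inv_of_mul_eq_one_left hx]
        simpa using (conj_pow (i := k) (a := x⁻¹) (b := m)).symm
      have hcomm : Commute x (m ^ k) := by
        rcases eq_or_eq_inv_of_orderOf hu (fun y _ => h y) hk (hcen _) with h1 | h1 <;> rw [h1]
        · exact hcen x
        · exact (hcen x).inv_right
      rw [mul_assoc, ← hcomm.eq, inv_mul_cancel_left] at hmx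
      exact inv_ne_self_of_orderOf hk hmx.symm
    by_contra hC
    obtain ⟨y, hy, hy2⟩ := exists_sq_eq_one_of_not_isCyclic hc M hM hinv hC
    rcases h y hy2 with rfl | rfl
    · exact hy M.one_mem
    · exact hy (M.pow_mem huM' 2)

theorem nonempty_mulEquiv_dihedralGroup {G : Type*} [Group G] [Finite G] {n : ℕ} [NeZero n]
    {a b : G} (ha : orderOf a = n) (hb : b * b = 1) (hab : b * a * b⁻¹ = a⁻¹)
    (hcard : Nat.card G = 2 * n)
    (hG : ∀ x, x ∈ Subgroup.zpowers a ∨ x * b⁻¹ ∈ Subgroup.zpowers a) :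
    Nonempty (G ≃* DihedralGroup n) := by
  have hadd (i j : ZMod n) : a ^ (i + j).val = a ^ i.val * a ^ j.val := by
    rw [ZMod.val_add, ← pow_add]
    nth_rw 2 [← pow_mod_orderOf]
    rw [ha]
  have hsub (i j : ZMod n) : a ^ (j - i).val = (a ^ i.val)⁻¹ * a ^ j.val := by
    rw [eq_inv_mul_iff_mul_eq, ← hadd, add_sub_cancel]
  have hb' : b⁻¹ = b := inv_eq_of_mul_eq_one_left hb
  have hconj (k : ℕ) : a ^ k * b = b * (a ^ k)⁻¹ := by
    have : b * a ^ k * b⁻¹ = (a ^ k)⁻¹ := by rw [← conj_pow, hab, inv_pow]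
    rw [← this, hb', mul_assoc b (a ^ k), ← mul_assoc b b, hb, one_mul]
  let f : DihedralGroup n →* G :=
    { toFun := fun x => match x with
        | .r i => a ^ i.val
        | .sr i => b * a ^ i.val
      map_one' := by
        change a ^ (0 : ZMod n).val = 1
        rw [ZMod.val_zero, pow_zero]
      map_mul' := by
        rintro (i | i) (j | j)
        · simp only [DihedralGroup.r_mul_r, hadd]
        · simp only [DihedralGroup.r_mul_sr, hsub]
          rw [← mul_assoc (a ^ i.val), hconj, mul_assoc]
        · simp only [DihedralGroup.sr_mul_r, hadd, mul_assoc]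
        · simp only [DihedralGroup.sr_mul_sr, hsub]
          rw [mul_assoc b, ← mul_assoc (a ^ i.val), hconj, mul_assoc b, ← mul_assoc b b, hb,
            one_mul] }
  have hmem {x : G} (hx : x ∈ Subgroup.zpowers a) : ∃ i : ZMod n, a ^ i.val = x := by
    obtain ⟨k, rfl⟩ := (mem_powers_iff_mem_zpowers.2 hx)
    exact ⟨k, by rw [ZMod.val_natCast, ← ha, pow_mod_orderOf]⟩
  have hsurj : Function.Surjective f := by
    intro x
    rcases hG x with hx | hx
    · obtain ⟨i, hi⟩ := hmem hx
      exact ⟨.r i, hi⟩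
    · obtain ⟨i, hi⟩ := hmem (Subgroup.inv_mem _ hx)
      refine ⟨.sr i, ?_⟩
      have := hconj i.val
      rw [hi, inv_inv, inv_mul_eq_iff_eq_mul, ← mul_assoc, ← mul_inv_eq_iff_eq_mul] at this
      change b * a ^ i.val = x
      rw [hi, this, inv_mul_cancel_right]
  exact ⟨(MulEquiv.ofBijective f
    ((Nat.bijective_iff_surjective_and_card f).2
      ⟨hsurj, by rw [DihedralGroup.nat_card, hcard]⟩)).symm⟩

section OrderEight

variable {H : Type*} [Group H] [Finite H] {u : H}

theorem eq_one_or_eq_sq_of_commute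
    (h8 : ∀ K : Subgroup H, Nat.card K = 8 → IsCyclic K ∨ Nonempty (K ≃* DihedralGroup 4))
    (hu : orderOf u = 4) {y : H} (hyu : Commute y u) (hy : y ^ 2 = 1) :
    y = 1 ∨ y = u ^ 2 := by
  by_cases hyA : y ∈ Subgroup.zpowers u
  · exact eq_one_or_eq_sq_of_mem_zpowers hu hyA hy
  exfalso
  have hcomm {a : H} (ha : a ∈ Subgroup.zpowers u) {x : H} (hx : Commute x u) : Commute x a := by
    obtain ⟨i, rfl⟩ := ha
    exact hx.zpow_right i
  obtain ⟨K, hK, hcard⟩ := (Subgroup.zpowers u).exists_card_eq_two_mul (b := y)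
    (fun a ha => by rwa [(hcomm ha hyu).eq, mul_inv_cancel_right])
    (by rw [← sq, hy]; exact Subgroup.one_mem _) hyA
  rw [Nat.card_zpowers, hu] at hcard
  have hKu {x : H} (hx : x ∈ K) : Commute x u := by
    rcases (hK x).1 hx with hx | hx
    · exact (hcomm hx (Commute.refl u)).symm
    · rw [← inv_mul_cancel_right x y]
      exact (hcomm hx (Commute.refl u)).symm.mul_left hyu
  have hKy {x : H} (hx : x ∈ K) : Commute x y := by
    rcases (hK x).1 hx with hx | hx
    · exact (hcomm hx hyu).symm
    · rw [← inv_mul_cancel_right x y]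
      exact (hcomm hx hyu).symm.mul_left (Commute.refl y)
  have hpow {x : H} (hx : x ∈ Subgroup.zpowers u) : x ^ 4 = 1 := by
    rw [← orderOf_dvd_iff_pow_eq_one, ← hu]
    exact orderOf_dvd_of_mem_zpowers hx
  rcases h8 K hcard with hcyc | ⟨⟨e⟩⟩
  · obtain ⟨g, hg⟩ := IsCyclic.exists_generator (α := K)
    have hg8 := orderOf_eq_card_of_forall_mem_zpowers hg
    have hg4 : g ^ 4 = 1 := by
      ext
      rw [Subgroup.coe_pow, Subgroup.coe_one]
      rcases (hK g).1 g.2 with hx | hx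
      · exact hpow hx
      · rw [← inv_mul_cancel_right (g : H) y, (hcomm hx hyu).symm.mul_pow, hpow hx, one_mul,
          show 4 = 2 * 2 from rfl, pow_mul, hy, one_pow]
    have := orderOf_dvd_of_pow_eq_one hg4
    rw [hg8, hcard] at this
    omega
  · have hKcomm (p q : K) : p * q = q * p := by
      ext
      rcases (hK q).1 q.2 with hx | hx
      · exact hcomm hx (hKu p.2)
      · have := (hcomm hx (hKu p.2)).mul_right (hKy p.2)
        rw [inv_mul_cancel_right] at this
        exact this
    have h := congrArg e (hKcomm (e.symm (.r 1)) (e.symm (.sr 0)))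
    simp only [map_mul, MulEquiv.apply_symm_apply] at h
    revert h
    decide

theorem sq_ne_sq_of_conj_eq_inv
    (h8 : ∀ K : Subgroup H, Nat.card K = 8 → IsCyclic K ∨ Nonempty (K ≃* DihedralGroup 4))
    (hu : orderOf u = 4) {b : H} (hb : b * u * b⁻¹ = u⁻¹) : b ^ 2 ≠ u ^ 2 := by
  intro hbu
  have hncomm : ¬ Commute b u := fun h => by
    rw [h.eq, mul_inv_cancel_right] at hb
    exact inv_ne_self_of_orderOf hu hb.symm
  have hconj {a : H} (ha : a ∈ Subgroup.zpowers u) : b * a * b⁻¹ = a⁻¹ := by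
    obtain ⟨i, rfl⟩ := ha
    simp only
    rw [← conj_zpow, hb, inv_zpow]
  have hbA : b ∉ Subgroup.zpowers u := by
    rintro ⟨i, rfl⟩
    exact hncomm ((Commute.refl u).zpow_left i)
  obtain ⟨K, hK, hcard⟩ := (Subgroup.zpowers u).exists_card_eq_two_mul (b := b)
    (fun a ha => by rw [hconj ha]; exact Subgroup.inv_mem _ ha)
    (by rw [← sq, hbu]; exact Subgroup.pow_mem _ (Subgroup.mem_zpowers u) 2) hbA
  rw [Nat.card_zpowers, hu] at hcard
  have huK : u ∈ K := (hK u).2 (Or.inl (Subgroup.mem_zpowers u))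
  have hbK : b ∈ K := (hK b).2 (Or.inr (by simp))
  rcases h8 K hcard with hcyc | ⟨⟨e⟩⟩
  · exact hncomm (congrArg Subtype.val
      (IsCyclic.isMulCommutative.is_comm.comm (⟨b, hbK⟩ : K) ⟨u, huK⟩))
  · have hinvol (x : DihedralGroup 4) (hx : x ^ 2 = 1) (hx1 : x ≠ 1) :
        (e.symm x : H) = u ^ 2 := by
      have hx2 : (e.symm x : H) ^ 2 = 1 := by
        rw [← Subgroup.coe_pow, ← map_pow, hx, map_one, Subgroup.coe_one]
      rcases (hK _).1 (e.symm x).2 with h | h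
      · refine (eq_one_or_eq_sq_of_mem_zpowers hu h hx2).resolve_left fun h1 => hx1 ?_
        simpa using h1
      · refine absurd ?_ (sq_ne_one_of_orderOf hu)
        have h1 := hconj h
        rw [← hbu, ← hx2]
        have h2 : b * (e.symm x : H) = b * (e.symm x * b⁻¹) * b⁻¹ * b ^ 2 := by group
        rw [h1, mul_inv_rev, inv_inv] at h2
        rw [mul_assoc, mul_right_inj, eq_inv_mul_iff_mul_eq] at h2
        rw [sq (e.symm x : H), h2]
    have h := (hinvol (.sr 0) (by decide) (by decide)).trans
      (hinvol (.sr 1) (by decide) (by decide)).symm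
    have h' := e.symm.injective (Subtype.ext h)
    revert h'
    decide

end OrderEight

theorem isCyclic_or_nonempty_mulEquiv_dihedralGroup_two {H : Type*} [Group H] [Finite H]
    (hH : IsPGroup 2 H) (hexp : ∀ g : H, g ^ 2 = 1) (hcard : ¬ 8 ∣ Nat.card H) :
    IsCyclic H ∨ Nonempty (H ≃* DihedralGroup 2) := by
  obtain ⟨n, hn⟩ := IsPGroup.iff_card.1 hH
  have hn3 : n < 3 := by
    by_contra! h
    exact hcard (hn ▸ pow_dvd_pow 2 h)
  interval_cases n
  · have : Subsingleton H := (Nat.card_eq_one_iff_unique.1 hn).1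
    exact Or.inl inferInstance
  · exact Or.inl (isCyclic_of_prime_card (p := 2) hn)
  · have hdvd : Monoid.exponent H ∣ 2 := Monoid.exponent_dvd_of_forall_pow_eq_one hexp
    have : IsKleinFour H := by
      refine ⟨hn, ((Nat.dvd_prime Nat.prime_two).1 hdvd).resolve_left fun h => ?_⟩
      have := Monoid.exp_eq_one_iff.1 h
      simp at hn
    exact Or.inr IsKleinFour.nonempty_mulEquiv

/-- Let `H` be a finite 2-group such that every subgroup of `H` of order 8
is either cyclic or dihedral. Then `H` itself is either cyclic or dihedral
(a dihedral group of order `2^m`, `m ≥ 2`, is `DihedralGroup (2^(m-1))`). -/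
theorem stmt1 {H : Type*} [Group H] [Finite H] (hH : IsPGroup 2 H)
    (h8 : ∀ K : Subgroup H, Nat.card K = 8 →
      IsCyclic K ∨ Nonempty (K ≃* DihedralGroup 4)) :
    IsCyclic H ∨ ∃ m : ℕ, 2 ≤ m ∧ Nonempty (H ≃* DihedralGroup (2 ^ (m - 1))) := by
  by_cases hex : ∀ g : H, g ^ 2 = 1
  · refine (isCyclic_or_nonempty_mulEquiv_dihedralGroup_two hH hex fun hdvd => ?_).imp_right
      fun h => ⟨2, le_rfl, h⟩
    obtain ⟨K, hK⟩ := Sylow.exists_subgroup_card_pow_prime 2 (n := 3) hdvd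
    have hexK (g : K) : g ^ 2 = 1 := Subtype.ext (hex g)
    rcases h8 K hK with hcyc | ⟨⟨e⟩⟩
    · obtain ⟨g, hg⟩ := IsCyclic.exists_generator (α := K)
      have hg8 := orderOf_eq_card_of_forall_mem_zpowers hg
      have := orderOf_dvd_of_pow_eq_one (hexK g)
      rw [hg8, hK] at this
      omega
    · have h := congrArg e (hexK (e.symm (.r 1)))
      simp only [map_pow, MulEquiv.apply_symm_apply, map_one] at h
      revert h
      decide
  push Not at hex
  obtain ⟨g, hg⟩ := hex
  obtain ⟨i, hu⟩ := hH.exists_orderOf_pow_eq_four hg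
  generalize g ^ i = u at hu
  have hinvol (y : H) (hy : Commute y u) (hy2 : y ^ 2 = 1) : y = 1 ∨ y = u ^ 2 :=
    eq_one_or_eq_sq_of_commute h8 hu hy hy2
  have hsq (b : H) (hb : b * u * b⁻¹ = u⁻¹) : b * b = 1 := by
    have hcomm : Commute (b * b) u := by
      rw [commute_iff_eq, ← mul_inv_eq_iff_eq_mul]
      calc b * b * u * (b * b)⁻¹ = b * (b * u * b⁻¹) * b⁻¹ := by group
        _ = (b * u * b⁻¹)⁻¹ := by rw [hb]; nth_rw 2 [← hb]; group
        _ = u := by rw [hb, inv_inv]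
    rw [← sq] at hcomm ⊢
    have h4 : (b ^ 2) ^ 2 = 1 := by
      by_contra h4
      obtain ⟨k, hk⟩ := hH.exists_orderOf_pow_eq_four h4
      have hbk : Commute b ((b ^ 2) ^ k) := ((Commute.refl b).pow_right 2).pow_right k
      have hbu : Commute b u := by
        rcases eq_or_eq_inv_of_orderOf hu hinvol hk (hcomm.pow_left k) with h | h <;> rw [h] at hbk
        · exact hbk
        · exact Commute.inv_right_iff.1 hbk
      rw [hbu.eq, mul_inv_cancel_right] at hb
      exact inv_ne_self_of_orderOf hu hb.symm
    exact (hinvol _ hcomm h4).resolve_right (sq_ne_sq_of_conj_eq_inv h8 hu hb)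
  have hnorm : Subgroup.normalizer (Subgroup.zpowers u : Set H) = ⊤ := by
    have : Group.IsNilpotent H := hH.isNilpotent
    refine normalizerCondition_iff_only_full_group_self_normalizing.1
      Group.normalizerCondition_of_isNilpotent _ (le_antisymm (fun g hg => ?_)
        Subgroup.le_normalizer)
    have hv : orderOf (g * u * g⁻¹) = 4 := (MulEquiv.orderOf_eq (MulAut.conj g) u).trans hu
    have hvN := (Subgroup.mem_normalizer_iff.1 hg u).1
      (Subgroup.le_normalizer (Subgroup.mem_zpowers u))
    rw [mem_normalizer_zpowers_iff_of_orderOf hu] at hvN ⊢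
    rcases hvN with h | h
    · exact eq_or_eq_inv_of_orderOf hu hinvol hv (mul_inv_eq_iff_eq_mul.1 h)
    · exact absurd ((sq _).trans (hsq _ h)) (sq_ne_one_of_orderOf hv)
  have hconj (g : H) : Commute g u ∨ g * u * g⁻¹ = u⁻¹ :=
    ((mem_normalizer_zpowers_iff_of_orderOf hu).1 (hnorm ▸ Subgroup.mem_top g)).imp_left
      mul_inv_eq_iff_eq_mul.1
  by_cases hcen : ∀ x, Commute x u
  · obtain ⟨n, hn⟩ := IsPGroup.iff_card.1 hH
    exact Or.inl (isCyclic_of_orderOf_eq_four hn hu hcen fun y => hinvol y (hcen y))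
  push Not at hcen
  obtain ⟨b, hbu⟩ := hcen
  have hb := (hconj b).resolve_left hbu
  let C := Subgroup.centralizer {u}
  have hmemC {x : H} : x ∈ C ↔ Commute x u :=
    Subgroup.mem_centralizer_singleton_iff
  have huC : u ∈ C := hmemC.2 (Commute.refl u)
  obtain ⟨n, hn⟩ := IsPGroup.iff_card.1 (hH.to_subgroup C)
  have huC4 : orderOf (⟨u, huC⟩ : C) = 4 := by rwa [Subgroup.orderOf_mk]
  have hCcyc : IsCyclic C := isCyclic_of_orderOf_eq_four hn huC4
    (fun x => Subtype.ext (hmemC.1 x.2)) fun y hy =>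
      (hinvol y (hmemC.1 y.2) (congrArg Subtype.val hy)).imp (fun h => Subtype.ext h)
        fun h => Subtype.ext h
  have hbb := hsq b hb
  have hb' : b⁻¹ = b := inv_eq_of_mul_eq_one_left hbb
  have hinv {c : H} (hc : c ∈ C) : b * c * b⁻¹ = c⁻¹ := by
    have := hsq (b * c) (by
      rw [mul_inv_rev, mul_assoc b, (hmemC.1 hc).eq, ← hb]
      group)
    rw [hb']
    exact eq_inv_of_mul_eq_one_left (by rwa [mul_assoc])
  obtain ⟨K, hK, hcard⟩ := C.exists_card_eq_two_mul (b := b)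
    (fun c hc => hinv hc ▸ C.inv_mem hc) (hbb ▸ C.one_mem) (fun h => hbu (hmemC.1 h))
  have hcover (x : H) : x ∈ C ∨ x * b⁻¹ ∈ C := by
    refine (hconj x).imp hmemC.2 fun hx => hmemC.2 ?_
    have h1 : b⁻¹ * u * b = u⁻¹ := by
      nth_rw 1 [hb']
      rw [← hb, hb']
    rw [commute_iff_eq, ← mul_inv_eq_iff_eq_mul]
    calc x * b⁻¹ * u * (x * b⁻¹)⁻¹ = x * (b⁻¹ * u * b) * x⁻¹ := by group
      _ = (x * u * x⁻¹)⁻¹ := by rw [h1]; group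
      _ = u := by rw [hx, inv_inv]
  have hKtop : K = ⊤ := (Subgroup.eq_top_iff' K).2 fun x => (hK x).2 (hcover x)
  rw [hKtop, Subgroup.card_top, hn] at hcard
  obtain ⟨a, ha⟩ := IsCyclic.exists_generator (α := C)
  have haord : orderOf (a : H) = 2 ^ n := by
    rw [Subgroup.orderOf_coe, orderOf_eq_card_of_forall_mem_zpowers ha, hn]
  have haC {x : H} (hx : x ∈ C) : x ∈ Subgroup.zpowers (a : H) := by
    obtain ⟨i, hi⟩ := ha ⟨x, hx⟩
    exact ⟨i, congrArg Subtype.val hi⟩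
  have hn1 : 1 ≤ n := by
    have := orderOf_dvd_natCard (⟨u, huC⟩ : C)
    rw [huC4, hn] at this
    by_contra! h
    interval_cases n
    omega
  exact Or.inr ⟨n + 1, by omega, nonempty_mulEquiv_dihedralGroup haord hbb (hinv a.2) hcard
    fun x => (hcover x).imp haC haC⟩
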